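/- Under the discrete projective Lelieuvre relations, the full determinant is preserved: at every point of ℤ², det(f,f₁,f₂,f₁₂) = det(ν,ν₁,ν₂,ν₁₂). -/

import Mathlib

noncomputable section

/-- Euclidean pairing on `ℝ⁴`. -/
def dot4 (a b : Fin 4 → ℝ) : ℝ := ∑ i, a i * b i

/-- Determinant of the 4×4 matrix with rows `a, b, c, d`. -/
def det4 (a b c d : Fin 4 → ℝ) : ℝ := Matrix.det (Matrix.of ![a, b, c, d])

/-- Shift in the first lattice direction. -/
def s1 (g : ℤ × ℤ → Fin 4 → ℝ) : ℤ × ℤ → Fin 4 → ℝ := fun m => g (m.1 + 1, m.2)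

/-- Shift in the second lattice direction. -/
def s2 (g : ℤ × ℤ → Fin 4 → ℝ) : ℤ × ℤ → Fin 4 → ℝ := fun m => g (m.1, m.2 + 1)

theorem dot4_single (i : Fin 4) (a : Fin 4 → ℝ) : dot4 (Pi.single i 1) a = a i := by
  simp [dot4, Pi.single_apply]

/-- Laplace expansion of a 4×4 determinant along its first two rows. -/
theorem det4_eq_laplace (a b c d : Fin 4 → ℝ) :
    det4 a b c d =
      (a 0 * b 1 - a 1 * b 0) * (c 2 * d 3 - c 3 * d 2)
      - (a 0 * b 2 - a 2 * b 0) * (c 1 * d 3 - c 3 * d 1)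
      + (a 0 * b 3 - a 3 * b 0) * (c 1 * d 2 - c 2 * d 1)
      + (a 1 * b 2 - a 2 * b 1) * (c 0 * d 3 - c 3 * d 0)
      - (a 1 * b 3 - a 3 * b 1) * (c 0 * d 2 - c 2 * d 0)
      + (a 2 * b 3 - a 3 * b 2) * (c 0 * d 1 - c 1 * d 0) := by
  simp [det4, Matrix.det_succ_row_zero, Fin.sum_univ_succ, Fin.succAbove]
  ring

/-- If `a ∧ b = ⋆(a' ∧ b')` in coordinates, the Plücker coordinates of `a ∧ b` are those of
`a' ∧ b'` at the complementary indices, up to sign. -/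
theorem plucker_eq_of_star {a b a' b' : Fin 4 → ℝ}
    (h : ∀ w z : Fin 4 → ℝ, dot4 w a * dot4 z b - dot4 z a * dot4 w b = det4 w z a' b') :
    a 0 * b 1 - a 1 * b 0 = a' 2 * b' 3 - a' 3 * b' 2 ∧
    a 0 * b 2 - a 2 * b 0 = -(a' 1 * b' 3 - a' 3 * b' 1) ∧
    a 0 * b 3 - a 3 * b 0 = a' 1 * b' 2 - a' 2 * b' 1 ∧
    a 1 * b 2 - a 2 * b 1 = a' 0 * b' 3 - a' 3 * b' 0 ∧
    a 1 * b 3 - a 3 * b 1 = -(a' 0 * b' 2 - a' 2 * b' 0) ∧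
    a 2 * b 3 - a 3 * b 2 = a' 0 * b' 1 - a' 1 * b' 0 := by
  have key (i j : Fin 4) := h (Pi.single i 1) (Pi.single j 1)
  simp only [dot4_single, det4_eq_laplace] at key
  refine ⟨(key 0 1).trans ?_, (key 0 2).trans ?_, (key 0 3).trans ?_, (key 1 2).trans ?_,
    (key 1 3).trans ?_, (key 2 3).trans ?_⟩ <;> simp

/-- The Hodge star preserves the wedge pairing on bivectors of `ℝ⁴`. -/
theorem det4_eq_of_star {a b c d a' b' c' d' : Fin 4 → ℝ}
    (h : ∀ w z : Fin 4 → ℝ, dot4 w a * dot4 z b - dot4 z a * dot4 w b = det4 w z a' b')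
    (k : ∀ w z : Fin 4 → ℝ, dot4 w c * dot4 z d - dot4 z c * dot4 w d = det4 w z c' d') :
    det4 a b c d = det4 a' b' c' d' := by
  obtain ⟨h₀₁, h₀₂, h₀₃, h₁₂, h₁₃, h₂₃⟩ := plucker_eq_of_star h
  obtain ⟨k₀₁, k₀₂, k₀₃, k₁₂, k₁₃, k₂₃⟩ := plucker_eq_of_star k
  rw [det4_eq_laplace, det4_eq_laplace, h₀₁, h₀₂, h₀₃, h₁₂, h₁₃, h₂₃,
    k₀₁, k₀₂, k₀₃, k₁₂, k₁₃, k₂₃]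
  ring

theorem stmt16 (f ν : ℤ × ℤ → Fin 4 → ℝ)
    (hpair : ∀ m, dot4 (f m) (ν m) = 0)
    (hL1 : ∀ m, ∀ w z : Fin 4 → ℝ,
      dot4 w (f m) * dot4 z (s1 f m) - dot4 z (f m) * dot4 w (s1 f m)
        = det4 w z (ν m) (s1 ν m))
    (hL2 : ∀ m, ∀ w z : Fin 4 → ℝ,
      dot4 w (f m) * dot4 z (s2 f m) - dot4 z (f m) * dot4 w (s2 f m)
        = - det4 w z (ν m) (s2 ν m))
    (hf0 : ∀ m, f m ≠ 0) (hν0 : ∀ m, ν m ≠ 0) :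
    ∀ m : ℤ × ℤ,
      det4 (f m) (s1 f m) (s2 f m) (s2 (s1 f) m)
        = det4 (ν m) (s1 ν m) (s2 ν m) (s2 (s1 ν) m) := by
  intro m
  exact det4_eq_of_star (hL1 m) (hL1 (m.1, m.2 + 1))
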